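/- arXiv:2205.00008 — 3 statements merged into one kernel-verified Lean document; each statement's English description precedes it below -/
import Mathlib

section
/- Let C = ⋃_{i∈I} C_i be a connected tree-like nodal curve with rational components and L a line bundle with degrees d_i. Write I = I_+ ∪ I_- according to d_i ≥ 0 or d_i < 0, let C_± be the corresponding subcurves, let e_i be the number of nodes joining C_i (for i ∈ I_+) to C_-, and let L_+ be the line bundle on C_+ with degrees d_i − e_i. Then h^0(C, L) = h^0(C_+, L_+). -/
open scoped BigOperators

/-- Evaluation of a binary form with `n` coefficients (degree `n - 1`) at the point `(a, b)`,
as a linear functional on the coefficient space. -/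
noncomputable def evalForm (n : ℕ) (a b : ℂ) : (Fin n → ℂ) →ₗ[ℂ] ℂ :=
  ∑ i : Fin n, (a ^ (i : ℕ) * b ^ (n - 1 - (i : ℕ))) • LinearMap.proj i

/-- The gluing condition at a node joining components `i` and `j`, with node coordinates
`p` on component `i` and `q` on component `j`. -/
noncomputable def glueCond {I : Type*} (m : I → ℕ) (i j : I) (p q : ℂ × ℂ) :
    (∀ k, Fin (m k) → ℂ) →ₗ[ℂ] ℂ :=
  (evalForm (m i) p.1 p.2).comp
      (LinearMap.proj i : (∀ k, Fin (m k) → ℂ) →ₗ[ℂ] (Fin (m i) → ℂ)) -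
    (evalForm (m j) q.1 q.2).comp
      (LinearMap.proj j : (∀ k, Fin (m k) → ℂ) →ₗ[ℂ] (Fin (m j) → ℂ))

/-- The space of global sections of a line bundle on a nodal curve with rational components:
the dual graph is `G`, component `i` carries sections with `m i` coefficients
(i.e. degree `m i - 1`), and for each edge the sections agree at the node. -/
noncomputable def nodalSections {I : Type*} (G : SimpleGraph I) (m : I → ℕ)
    (node : ∀ i j, G.Adj i j → ℂ × ℂ) : Submodule ℂ (∀ k, Fin (m k) → ℂ) :=
  ⨅ (i) (j) (h : G.Adj i j),
    LinearMap.ker (glueCond m i j (node i j h) (node j i h.symm))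

/-- The nodes are genuine points of `ℙ¹` (nonzero coordinates) and the nodes lying on one
and the same component are pairwise distinct as points of `ℙ¹`. -/
def NodesOk {I : Type*} (G : SimpleGraph I) (node : ∀ i j, G.Adj i j → ℂ × ℂ) : Prop :=
  (∀ i j (h : G.Adj i j), node i j h ≠ 0) ∧
    ∀ i j j' (h : G.Adj i j) (h' : G.Adj i j'), j ≠ j' →
      (node i j h).1 * (node i j' h').2 ≠ (node i j' h').1 * (node i j h).2

/-- The number of nodes joining component `i` to components of negative degree. -/
def eNeg {I : Type*} [Fintype I] (G : SimpleGraph I) [DecidableRel G.Adj]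
    (d : I → ℤ) (i : I) : ℕ :=
  (Finset.univ.filter fun j => G.Adj i j ∧ d j < 0).card


theorem evalForm_apply (n : ℕ) (a b : ℂ) (f : Fin n → ℂ) :
    evalForm n a b f = ∑ i : Fin n, (a ^ (i : ℕ) * b ^ (n - 1 - (i : ℕ))) * f i := by
  simp [evalForm]

/-- multiplication by the linear form vanishing at `s` -/
noncomputable def mulLin (n : ℕ) (s : ℂ × ℂ) : (Fin n → ℂ) →ₗ[ℂ] (Fin (n + 1) → ℂ) where
  toFun g := fun i => s.2 * (Fin.cons 0 g : Fin (n + 1) → ℂ) i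
    - s.1 * (Fin.snoc g 0 : Fin (n + 1) → ℂ) i
  map_add' g h := by
    funext i
    have h1 : (Fin.cons 0 (g + h) : Fin (n + 1) → ℂ) i
      = (Fin.cons 0 g : Fin (n + 1) → ℂ) i + (Fin.cons 0 h : Fin (n + 1) → ℂ) i := by
      refine Fin.cases ?_ (fun j => ?_) i <;> simp
    have h2 : (Fin.snoc (g + h) 0 : Fin (n + 1) → ℂ) i
      = (Fin.snoc g 0 : Fin (n + 1) → ℂ) i + (Fin.snoc h 0 : Fin (n + 1) → ℂ) i := by
      refine Fin.lastCases ?_ (fun j => ?_) i <;> simp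
    simp only [h1, h2, Pi.add_apply]; ring
  map_smul' c g := by
    funext i
    have h1 : (Fin.cons 0 (c • g) : Fin (n + 1) → ℂ) i
      = c * (Fin.cons 0 g : Fin (n + 1) → ℂ) i := by
      refine Fin.cases ?_ (fun j => ?_) i <;> simp
    have h2 : (Fin.snoc (c • g) 0 : Fin (n + 1) → ℂ) i
      = c * (Fin.snoc g 0 : Fin (n + 1) → ℂ) i := by
      refine Fin.lastCases ?_ (fun j => ?_) i <;> simp
    simp only [h1, h2, Pi.smul_apply, smul_eq_mul, RingHom.id_apply]; ring

theorem mulLin_apply (n : ℕ) (s : ℂ × ℂ) (g : Fin n → ℂ) (i : Fin (n + 1)) :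
    mulLin n s g i = s.2 * (Fin.cons 0 g : Fin (n + 1) → ℂ) i
    - s.1 * (Fin.snoc g 0 : Fin (n + 1) → ℂ) i := rfl

theorem eval_mulLin (n : ℕ) (s : ℂ × ℂ) (g : Fin n → ℂ) (a b : ℂ) :
    evalForm (n + 1) a b (mulLin n s g) = (a * s.2 - s.1 * b) * evalForm n a b g := by
  simp only [evalForm_apply, mulLin_apply, mul_sub, Finset.sum_sub_distrib]
  rw [Fin.sum_univ_succ, Fin.sum_univ_castSucc
    (fun i : Fin (n + 1) => a ^ (i : ℕ) * b ^ (n + 1 - 1 - (i : ℕ)) *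
      (s.1 * (Fin.snoc g 0 : Fin (n + 1) → ℂ) i))]
  simp only [Fin.cons_zero, Fin.cons_succ, Fin.snoc_castSucc, Fin.snoc_last, mul_zero, zero_add,
    add_zero, sub_mul, Finset.mul_sum, Finset.sum_sub_distrib, Fin.val_succ, Fin.val_castSucc]
  congr 1
  · refine Finset.sum_congr rfl fun i _ => ?_
    have : n + 1 - 1 - ((i : ℕ) + 1) = n - 1 - i := by omega
    rw [this]; ring
  · refine Finset.sum_congr rfl fun i _ => ?_
    have : n + 1 - 1 - (i : ℕ) = n - 1 - i + 1 := by omega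
    rw [this]; ring

theorem mulLin_inj (n : ℕ) (s : ℂ × ℂ) (hs : s ≠ 0) : Function.Injective (mulLin n s) := by
  rw [injective_iff_map_eq_zero]
  intro g hg
  have hk : ∀ i, s.2 * (Fin.cons 0 g : Fin (n + 1) → ℂ) i
    - s.1 * (Fin.snoc g 0 : Fin (n + 1) → ℂ) i = 0 := fun i => by
      rw [← mulLin_apply, hg]; rfl
  by_cases h1 : s.1 = 0
  · have h2 : s.2 ≠ 0 := fun h2 => hs (Prod.ext h1 h2)
    funext i
    have := hk i.succ
    simpa [h1, h2] using this
  · have key : ∀ k : ℕ, ∀ hkn : k < n, g ⟨k, hkn⟩ = 0 := by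
      intro k
      induction k with
      | zero =>
        intro hkn
        have := hk (Fin.castSucc ⟨0, hkn⟩)
        have e : (Fin.castSucc (⟨0, hkn⟩ : Fin n)) = 0 := rfl
        rw [Fin.snoc_castSucc, e, Fin.cons_zero] at this
        simpa [h1] using this
      | succ k ih =>
        intro hkn
        have := hk (Fin.castSucc ⟨k + 1, hkn⟩)
        have e : (Fin.castSucc (⟨k + 1, hkn⟩ : Fin n)) = Fin.succ ⟨k, by omega⟩ := rfl
        rw [Fin.snoc_castSucc, e, Fin.cons_succ, ih] at this
        simpa [h1] using this
    funext i
    exact key i i.2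

theorem evalForm_ne (n : ℕ) (s : ℂ × ℂ) (hs : s ≠ 0) : evalForm (n + 1) s.1 s.2 ≠ 0 := by
  intro h
  by_cases h1 : s.1 = 0
  · have h2 : s.2 ≠ 0 := fun h2 => hs (Prod.ext h1 h2)
    have := congrArg (fun l => l (Pi.single 0 1)) h
    simp [evalForm_apply, Pi.single_apply, h2] at this
  · have := congrArg (fun l => l (Pi.single (Fin.last n) 1)) h
    simp [evalForm_apply, Pi.single_apply, h1] at this

theorem mulLin_range (n : ℕ) (s : ℂ × ℂ) (hs : s ≠ 0) :
    LinearMap.range (mulLin n s) = LinearMap.ker (evalForm (n + 1) s.1 s.2) := by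
  apply Submodule.eq_of_le_of_finrank_eq
  · rintro _ ⟨g, rfl⟩
    rw [LinearMap.mem_ker, eval_mulLin]
    ring
  · rw [LinearMap.finrank_range_of_inj (mulLin_inj n s hs)]
    have h := Module.Dual.finrank_ker_add_one_of_ne_zero (evalForm_ne n s hs)
    simp at h ⊢
    omega

theorem exists_mul {J : Type*} [DecidableEq J] (p : J → ℂ × ℂ) (S : Finset J) :
    (∀ s ∈ S, p s ≠ 0) →
    (∀ s ∈ S, ∀ t ∈ S, s ≠ t → (p s).1 * (p t).2 ≠ (p t).1 * (p s).2) →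
    ∀ n m : ℕ, m = n - S.card →
    ∃ T : (Fin m → ℂ) →ₗ[ℂ] (Fin n → ℂ), Function.Injective T ∧
      (∀ a b g, evalForm n a b (T g)
        = (∏ s ∈ S, (a * (p s).2 - (p s).1 * b)) * evalForm m a b g) ∧
      ∀ f, (∀ s ∈ S, evalForm n (p s).1 (p s).2 f = 0) → ∃ g, T g = f := by
  induction S using Finset.induction_on with
  | empty =>
    intro _ _ n m h
    simp at h
    subst h
    exact ⟨LinearMap.id, Function.injective_id, by simp, fun f _ => ⟨f, rfl⟩⟩
  | insert s S hsS ih =>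
    intro h0 hd n m hm
    rw [Finset.card_insert_of_notMem hsS] at hm
    rcases n with _ | n
    · have : m = 0 := by omega
      subst this
      refine ⟨LinearMap.id, Function.injective_id, fun a b g => by simp [evalForm_apply],
        fun f _ => ⟨f, rfl⟩⟩
    · obtain ⟨T, hT, hE, hR⟩ := ih (fun t ht => h0 t (Finset.mem_insert_of_mem ht))
        (fun t ht u hu => hd t (Finset.mem_insert_of_mem ht) u (Finset.mem_insert_of_mem hu))
        n m (by omega)
      have hs := h0 s (Finset.mem_insert_self _ _)
      refine ⟨(mulLin n (p s)).comp T, (mulLin_inj n _ hs).comp hT, ?_, ?_⟩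
      · intro a b g
        rw [LinearMap.comp_apply, eval_mulLin, hE, Finset.prod_insert hsS, mul_assoc]
      · intro f hf
        have hfs : f ∈ LinearMap.range (mulLin n (p s)) := by
          rw [mulLin_range n _ hs]
          exact hf s (Finset.mem_insert_self _ _)
        obtain ⟨g, rfl⟩ := hfs
        obtain ⟨h, rfl⟩ := hR g (fun t ht => by
          have := hf t (Finset.mem_insert_of_mem ht)
          rw [eval_mulLin] at this
          refine (mul_eq_zero.1 this).resolve_left ?_
          refine sub_ne_zero.2 ?_
          exact hd t (Finset.mem_insert_of_mem ht) s (Finset.mem_insert_self _ _)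
            (fun e => hsS (e ▸ ht)))
        exact ⟨h, rfl⟩

theorem tree_scale {I : Type*} (G : SimpleGraph I) (hG : G.IsTree)
    (u : I → I → ℂ) (hu : ∀ i j, u i j ≠ 0) :
    ∃ c : I → ℂ, (∀ i, c i ≠ 0) ∧ ∀ i j, G.Adj i j → c i * u i j = c j * u j i := by
  classical
  obtain ⟨r⟩ := hG.1.nonempty
  let W : ∀ v w : I, G.Walk v w → ℂ := fun v w p =>
    (p.darts.map fun x => u x.fst x.snd / u x.snd x.fst).prod
  choose P hP hU using fun v => hG.existsUnique_path r v
  have hW : ∀ i j (h : G.Adj i j), P j = (P i).concat h →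
      W r i (P i) * u i j = W r j (P j) * u j i := by
    intro i j h e
    rw [e]
    simp only [W, SimpleGraph.Walk.darts_concat, List.concat_eq_append, List.map_append,
      List.prod_append, List.map_cons, List.map_nil, List.prod_cons, List.prod_nil, mul_one]
    have := hu j i
    field_simp
  refine ⟨fun v => W r v (P v), fun v => ?_, fun i j h => ?_⟩
  · refine List.prod_ne_zero ?_
    simp [hu]
  · by_cases hj : j ∈ (P i).support
    · have hi : i ∉ (P j).support := by
        intro hi
        exact hG.2.ne_mem_support_of_support_of_adj_of_isPath (hP i) (hP j) h hj hi
      have := (hU i ((P j).concat h.symm) ((hP j).concat hi h.symm)).symm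
      exact (hW j i h.symm this).symm
    · exact hW i j h (hU j ((P i).concat h) ((hP i).concat hj h)).symm

theorem mem_nodalSections {I : Type*} (G : SimpleGraph I) (m : I → ℕ)
    (node : ∀ i j, G.Adj i j → ℂ × ℂ) (f : ∀ k, Fin (m k) → ℂ) :
    f ∈ nodalSections G m node ↔ ∀ i j (h : G.Adj i j),
      evalForm (m i) (node i j h).1 (node i j h).2 (f i)
        = evalForm (m j) (node j i h.symm).1 (node j i h.symm).2 (f j) := by
  simp [nodalSections, glueCond, Submodule.mem_iInf, sub_eq_zero]

theorem evalForm_zero' (n : ℕ) (hn : n = 0) (a b : ℂ) (f : Fin n → ℂ) :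
    evalForm n a b f = 0 := by
  subst hn; simp [evalForm_apply]

/-- For a connected tree-like rational nodal curve `C` with degrees `d i ∈ ℤ`,
`h⁰(C, L) = h⁰(C₊, L₊)`, where `C₊` is the subcurve of components of nonnegative degree
and `L₊` has degrees `d i - e i`.  (A component of degree `d` has `(d+1).toNat`
coefficients, so negative-degree components carry only the zero section.) -/
theorem statement3 {I : Type} [Fintype I] [DecidableEq I]
    (G : SimpleGraph I) [DecidableRel G.Adj] (hG : G.IsTree) (d : I → ℤ)
    (node : ∀ i j, G.Adj i j → ℂ × ℂ) (hnode : NodesOk G node) :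
    Module.finrank ℂ ↥(nodalSections G (fun i => (d i + 1).toNat) node)
      = Module.finrank ℂ
          ↥(nodalSections (G.comap (Subtype.val : {i : I // 0 ≤ d i} → I))
            (fun i => (d i.1 - (eNeg G d i.1 : ℤ) + 1).toNat)
            (fun i j h => node i.1 j.1 h)) := by
  classical
  let p : I → I → ℂ × ℂ := fun i j => if h : G.Adj i j then node i j h else 0
  have hp : ∀ i j (h : G.Adj i j), p i j = node i j h := fun i j h => by simp [p, h]
  let S : I → Finset I := fun i => Finset.univ.filter fun j => G.Adj i j ∧ d j < 0
  have hS : ∀ i j, j ∈ S i ↔ G.Adj i j ∧ d j < 0 := fun i j => by simp [S]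
  have hex := fun i => exists_mul (p i) (S i)
    (fun s hs => by rw [hp i s ((hS i s).1 hs).1]; exact hnode.1 _ _ _)
    (fun s hs t ht hst => by
      rw [hp i s ((hS i s).1 hs).1, hp i t ((hS i t).1 ht).1]
      exact hnode.2 _ _ _ _ _ hst)
    (d i + 1).toNat (d i - (eNeg G d i : ℤ) + 1).toNat
    (by
      have : eNeg G d i = (S i).card := rfl
      rw [this]; omega)
  choose T hTi hTE hTR using hex
  let Q : I → I → ℂ := fun i j => ∏ s ∈ S i, ((p i j).1 * (p i s).2 - (p i s).1 * (p i j).2)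
  have hQ : ∀ i j, G.Adj i j → 0 ≤ d j → Q i j ≠ 0 := by
    intro i j h hj
    refine Finset.prod_ne_zero_iff.2 fun s hs => ?_
    obtain ⟨h1, h2⟩ := (hS i s).1 hs
    rw [sub_ne_zero, hp i j h, hp i s h1]
    exact hnode.2 _ _ _ _ _ (by rintro rfl; omega)
  let u : I → I → ℂ := fun i j => if Q i j = 0 then 1 else Q i j
  obtain ⟨c, hc0, hc⟩ := tree_scale G hG u (fun i j => by
    by_cases h : Q i j = 0 <;> simp [u, h])
  have hcQ : ∀ i j, G.Adj i j → 0 ≤ d i → 0 ≤ d j → c i * Q i j = c j * Q j i := by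
    intro i j h hi hj
    have := hc i j h
    simpa [u, hQ i j h hj, hQ j i h.symm hi] using this
  let Φ : (∀ k : {i : I // 0 ≤ d i}, Fin (d k.1 - (eNeg G d k.1 : ℤ) + 1).toNat → ℂ) →ₗ[ℂ]
      (∀ k : I, Fin (d k + 1).toNat → ℂ) :=
    LinearMap.pi fun k => if h : 0 ≤ d k then
      c k • (T k).comp (LinearMap.proj (⟨k, h⟩ : {i : I // 0 ≤ d i})) else 0
  have hΦ : ∀ g k (h : 0 ≤ d k), Φ g k = c k • T k (g ⟨k, h⟩) := by
    intro g k h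
    simp [Φ, h]
  have hinj : Function.Injective Φ := by
    intro g g' e
    funext k
    have := congrFun e k.1
    rw [hΦ g k.1 k.2, hΦ g' k.1 k.2] at this
    exact hTi k.1 (smul_right_injective _ (hc0 k.1) this)
  have hev : ∀ g i j (h : G.Adj i j) (hi : 0 ≤ d i),
      evalForm (d i + 1).toNat (node i j h).1 (node i j h).2 (Φ g i)
        = c i * Q i j * evalForm (d i - (eNeg G d i : ℤ) + 1).toNat
          (node i j h).1 (node i j h).2 (g ⟨i, hi⟩) := by
    intro g i j h hi
    rw [hΦ g i hi, map_smul, hTE, smul_eq_mul, mul_assoc]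
    simp only [Q, hp i j h]
  have hQ0 : ∀ i j, G.Adj i j → d j < 0 → Q i j = 0 := by
    intro i j h hj
    refine Finset.prod_eq_zero ((hS i j).2 ⟨h, hj⟩) ?_
    ring
  have hmap : (nodalSections (G.comap (Subtype.val : {i : I // 0 ≤ d i} → I))
            (fun i => (d i.1 - (eNeg G d i.1 : ℤ) + 1).toNat)
            (fun i j h => node i.1 j.1 h)).map Φ
      = nodalSections G (fun i => (d i + 1).toNat) node := by
    apply le_antisymm
    · rintro _ ⟨g, hg, rfl⟩
      have hg' := (mem_nodalSections _ _ _ _).1 hg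
      rw [mem_nodalSections]
      intro i j h
      by_cases hi : 0 ≤ d i
      · by_cases hj : 0 ≤ d j
        · have := hg' ⟨i, hi⟩ ⟨j, hj⟩ h
          rw [hev g i j h hi, hev g j i h.symm hj, hcQ i j h hi hj]
          exact congrArg _ this
        · rw [hev g i j h hi, hQ0 i j h (by omega), evalForm_zero' (d j + 1).toNat (by omega)]
          simp
      · rw [evalForm_zero' (d i + 1).toNat (by omega)]
        by_cases hj : 0 ≤ d j
        · rw [hev g j i h.symm hj, hQ0 j i h.symm (by omega)]
          simp
        · rw [evalForm_zero' (d j + 1).toNat (by omega)]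
    · intro f hf
      rw [mem_nodalSections] at hf
      have hg : ∀ k : {i : I // 0 ≤ d i}, ∃ g, T k.1 g = (c k.1)⁻¹ • f k.1 := by
        intro k
        apply hTR
        intro s hs
        obtain ⟨h1, h2⟩ := (hS k.1 s).1 hs
        have := hf k.1 s h1
        rw [evalForm_zero' (d s + 1).toNat (by omega)] at this
        rw [map_smul, hp _ _ h1, this, smul_zero]
      choose g hg using hg
      have hfg : Φ g = f := by
        funext k
        by_cases hk : 0 ≤ d k
        · rw [hΦ g k hk, hg ⟨k, hk⟩, smul_inv_smul₀ (hc0 k)]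
        · funext x
          have := x.2
          omega
      refine ⟨g, ?_, hfg⟩
      refine (mem_nodalSections _ _ _ _).2 ?_
      intro i j h
      have := hf i.1 j.1 h
      rw [← hfg] at this
      have e1 := hev g i.1 j.1 h i.2
      have e2 := hev g j.1 i.1 h.symm j.2
      rw [← hcQ i.1 j.1 h i.2 j.2] at e2
      exact mul_left_cancel₀ (mul_ne_zero (hc0 i.1) (hQ i.1 j.1 h j.2))
        (e1.symm.trans (this.trans e2))
  rw [← hmap]
  exact (Submodule.equivMapOfInjective Φ hinj _).finrank_eq.symm
end

section
/- The 7×10 complex matrix A (below), encoding gluing conditions of a multidegree (1,2,2,1) line bundle on the circuit of four P^1's with nodes in general position parametrized by a, b ∈ C \ {0,1} and gluing data λ_1, λ_4, λ_5, λ_7 ∈ C^*, has all 7×7 minors equal to zero if and only if λ_1 = 1/(a−1), λ_4 = b/(a(b−1)), λ_5 = b/(a(a−1)), λ_7 = b−1; for these values the null space of A is 4-dimensional, and for generic parameters it is 3-dimensional. -/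
/-- The 7×10 gluing matrix of a multidegree `(1,2,2,1)` line bundle on the circuit of
four ℙ¹'s, with node positions `a, b` and descent data `λ₁, λ₄, λ₅, λ₇`. -/
noncomputable def circuitMatrix (a b l1 l4 l5 l7 : ℂ) : Matrix (Fin 7) (Fin 10) ℂ :=
  !![l1, 0, -1, 0, 0, 0, 0, 0, 0, 0;
     1, 1, 0, 0, 0, -1, 0, 0, 0, 0;
     0, 1, 0, 0, 0, 0, 0, 0, -1, 0;
     0, 0, 1, 1, 1, -l4, -l4, -l4, 0, 0;
     0, 0, 0, 0, 1, 0, 0, -l5, 0, 0;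
     0, 0, 1, a, a ^ 2, 0, 0, 0, -1, -1;
     0, 0, 0, 0, 0, 1, b, b ^ 2, 0, -l7]

theorem circuit_col (a b l1 l4 l5 l7 : ℂ) (y : Fin 7 → ℂ) :
    Matrix.vecMul y (circuitMatrix a b l1 l4 l5 l7) =
      ![l1 * y 0 + y 1, y 1 + y 2, - y 0 + y 3 + y 5, y 3 + a * y 5, y 3 + y 4 + a ^ 2 * y 5,
        - y 1 - l4 * y 3 + y 6, - l4 * y 3 + b * y 6, - l4 * y 3 - l5 * y 4 + b ^ 2 * y 6,
        - y 2 - y 5, - y 5 - l7 * y 6] := by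
  funext j
  fin_cases j <;> simp [Matrix.vecMul, dotProduct, circuitMatrix, Fin.sum_univ_succ] <;> ring

theorem circuit_core (a b l1 l4 l5 l7 : ℂ) (y : Fin 7 → ℂ) (hy : y ≠ 0)
    (h : ∀ j ∈ ([1, 2, 3, 4, 5, 8] : List (Fin 10)),
      Matrix.vecMul y (circuitMatrix a b l1 l4 l5 l7) j = 0) :
    y 5 ≠ 0 ∧ y 0 = (1 - a) * y 5 ∧ y 1 = y 5 ∧ y 2 = - y 5 ∧ y 3 = - a * y 5 ∧
      y 4 = (a - a ^ 2) * y 5 ∧ y 6 = (1 - a * l4) * y 5 := by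
  rw [circuit_col] at h
  simp at h
  obtain ⟨e1, e2, e3, e4, e5, e8⟩ := h
  have k2 : y 2 = - y 5 := by linear_combination - e8
  have k1 : y 1 = y 5 := by linear_combination e1 - k2
  have k3 : y 3 = - a * y 5 := by linear_combination e3
  have k0 : y 0 = (1 - a) * y 5 := by linear_combination k3 - e2
  have k4 : y 4 = (a - a ^ 2) * y 5 := by linear_combination e4 - k3
  have k6 : y 6 = (1 - a * l4) * y 5 := by linear_combination e5 + k1 + l4 * k3
  refine ⟨?_, k0, k1, k2, k3, k4, k6⟩
  intro h5
  apply hy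
  funext i
  fin_cases i <;> simp [*]

/-- If the four bordered conditions hold then the parameters are determined. -/
theorem circuit_params (a b l1 l4 l5 l7 : ℂ)
    (ha0 : a ≠ 0) (ha1 : a ≠ 1) (hb1 : b ≠ 1)
    (e0 : l1 * (1 - a) + 1 = 0) (e6 : l4 * a + b * (1 - a * l4) = 0)
    (e7 : l4 * a - l5 * (a - a ^ 2) + b ^ 2 * (1 - a * l4) = 0)
    (e9 : - 1 - l7 * (1 - a * l4) = 0) :
    l1 = 1 / (a - 1) ∧ l4 = b / (a * (b - 1)) ∧ l5 = b / (a * (a - 1)) ∧ l7 = b - 1 := by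
  have ha : a - 1 ≠ 0 := sub_ne_zero.2 ha1
  have hb : b - 1 ≠ 0 := sub_ne_zero.2 hb1
  refine ⟨?_, ?_, ?_, ?_⟩
  · rw [eq_div_iff ha]; linear_combination - e0
  · rw [eq_div_iff (mul_ne_zero ha0 hb)]; linear_combination - e6
  · rw [eq_div_iff (mul_ne_zero ha0 ha)]; linear_combination e7 - (b + 1) * e6
  · linear_combination l7 * e6 + (b - 1) * e9

def circuitVec (a l4 : ℂ) : Fin 7 → ℂ := ![1 - a, 1, -1, -a, a - a ^ 2, 1, 1 - a * l4]

theorem circuit_vec (a b l1 l4 l5 l7 : ℂ)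
    (ha0 : a ≠ 0) (ha1 : a ≠ 1) (hb1 : b ≠ 1)
    (h : l1 = 1 / (a - 1) ∧ l4 = b / (a * (b - 1)) ∧
          l5 = b / (a * (a - 1)) ∧ l7 = b - 1) :
    Matrix.vecMul (circuitVec a l4) (circuitMatrix a b l1 l4 l5 l7) = 0 := by
  have ha : a - 1 ≠ 0 := sub_ne_zero.2 ha1
  have hb : b - 1 ≠ 0 := sub_ne_zero.2 hb1
  obtain ⟨h1, h4, h5, h7⟩ := h
  rw [eq_div_iff ha] at h1
  rw [eq_div_iff (mul_ne_zero ha0 hb)] at h4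
  rw [eq_div_iff (mul_ne_zero ha0 ha)] at h5
  rw [circuit_col]
  funext j
  fin_cases j <;> simp [circuitVec]
  · linear_combination - h1
  · ring
  · ring
  · ring
  · linear_combination - h4
  · linear_combination h5 - (b + 1) * h4
  · rw [h7]; linear_combination h4

theorem circuitVec_ne (a l4 : ℂ) : circuitVec a l4 ≠ 0 := by
  intro h
  have := congrFun h 1
  simp [circuitVec] at this

theorem circuit_finrank (M : Matrix (Fin 7) (Fin 10) ℂ) :
    Module.finrank ℂ (LinearMap.ker M.mulVecLin) =
      3 + Module.finrank ℂ (LinearMap.ker M.transpose.mulVecLin) := by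
  have e1 := LinearMap.finrank_range_add_finrank_ker M.mulVecLin
  have e2 := LinearMap.finrank_range_add_finrank_ker M.transpose.mulVecLin
  have e3 := Matrix.rank_transpose M
  simp only [Matrix.rank] at e3
  simp at e1 e2
  omega

theorem circuit_ker (a b l1 l4 l5 l7 : ℂ)
    (ha0 : a ≠ 0) (ha1 : a ≠ 1) (hb1 : b ≠ 1) (y : Fin 7 → ℂ) (hy : y ≠ 0)
    (h : Matrix.vecMul y (circuitMatrix a b l1 l4 l5 l7) = 0) :
    (l1 = 1 / (a - 1) ∧ l4 = b / (a * (b - 1)) ∧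
          l5 = b / (a * (a - 1)) ∧ l7 = b - 1) := by
  obtain ⟨h5, k0, k1, k2, k3, k4, k6⟩ := circuit_core a b l1 l4 l5 l7 y hy (by simp [h])
  rw [circuit_col] at h
  have e0 := congrFun h 0
  have e6 := congrFun h 6
  have e7 := congrFun h 7
  have e9 := congrFun h 9
  simp [k0, k1, k3, k4, k6] at e0 e6 e7 e9
  apply circuit_params a b l1 l4 l5 l7 ha0 ha1 hb1 <;> apply mul_right_cancel₀ h5
  · linear_combination e0
  · linear_combination e6
  · linear_combination e7
  · linear_combination e9

theorem circuit_minor (a b l1 l4 l5 l7 : ℂ) (k : Fin 10)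
    (hk : k ∉ ([1, 2, 3, 4, 5, 8] : List (Fin 10)))
    (h : ∀ c : Fin 7 → Fin 10, Function.Injective c →
        ((circuitMatrix a b l1 l4 l5 l7).submatrix id c).det = 0) :
    Matrix.vecMul (circuitVec a l4) (circuitMatrix a b l1 l4 l5 l7) k = 0 := by
  have hc : Function.Injective (![1, 2, 3, 4, 5, 8, k] : Fin 7 → Fin 10) := by
    revert k; decide
  obtain ⟨y, hy, hz⟩ := Matrix.exists_vecMul_eq_zero_iff.2 (h _ hc)
  have hz' : ∀ i, Matrix.vecMul y (circuitMatrix a b l1 l4 l5 l7)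
      ((![1, 2, 3, 4, 5, 8, k] : Fin 7 → Fin 10) i) = 0 := fun i => congrFun hz i
  obtain ⟨h5, k0, k1, k2, k3, k4, k6⟩ := circuit_core a b l1 l4 l5 l7 y hy (by
    intro j hj
    simp only [List.mem_cons, List.not_mem_nil, or_false] at hj
    rcases hj with rfl | rfl | rfl | rfl | rfl | rfl
    · exact hz' 0
    · exact hz' 1
    · exact hz' 2
    · exact hz' 3
    · exact hz' 4
    · exact hz' 5)
  have hyv : y = y 5 • circuitVec a l4 := by
    funext i
    fin_cases i <;> simp [circuitVec, k0, k1, k2, k3, k4, k6, mul_comm]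
  have := hz' 6
  rw [hyv, Matrix.smul_vecMul] at this
  simpa [h5] using this

/-- All 7×7 minors of the circuit matrix vanish iff
`λ₁ = 1/(a-1)`, `λ₄ = b/(a(b-1))`, `λ₅ = b/(a(a-1))`, `λ₇ = b-1`;
for these values the null space is 4-dimensional, and otherwise it is 3-dimensional. -/
theorem statement11 (a b l1 l4 l5 l7 : ℂ)
    (ha0 : a ≠ 0) (ha1 : a ≠ 1) (hb0 : b ≠ 0) (hb1 : b ≠ 1)
    (h1 : l1 ≠ 0) (h4 : l4 ≠ 0) (h5 : l5 ≠ 0) (h7 : l7 ≠ 0) :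
    ((∀ c : Fin 7 → Fin 10, Function.Injective c →
        ((circuitMatrix a b l1 l4 l5 l7).submatrix id c).det = 0)
      ↔ (l1 = 1 / (a - 1) ∧ l4 = b / (a * (b - 1)) ∧
          l5 = b / (a * (a - 1)) ∧ l7 = b - 1))
    ∧ ((l1 = 1 / (a - 1) ∧ l4 = b / (a * (b - 1)) ∧
          l5 = b / (a * (a - 1)) ∧ l7 = b - 1) →
        Module.finrank ℂ
          ↥(LinearMap.ker (circuitMatrix a b l1 l4 l5 l7).mulVecLin) = 4)
    ∧ (¬ (l1 = 1 / (a - 1) ∧ l4 = b / (a * (b - 1)) ∧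
          l5 = b / (a * (a - 1)) ∧ l7 = b - 1) →
        Module.finrank ℂ
          ↥(LinearMap.ker (circuitMatrix a b l1 l4 l5 l7).mulVecLin) = 3) := by
  refine ⟨⟨?_, ?_⟩, ?_, ?_⟩
  · intro h
    have e0 := circuit_minor a b l1 l4 l5 l7 0 (by decide) h
    have e6 := circuit_minor a b l1 l4 l5 l7 6 (by decide) h
    have e7 := circuit_minor a b l1 l4 l5 l7 7 (by decide) h
    have e9 := circuit_minor a b l1 l4 l5 l7 9 (by decide) h
    rw [circuit_col] at e0 e6 e7 e9
    simp [circuitVec] at e0 e6 e7 e9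
    apply circuit_params a b l1 l4 l5 l7 ha0 ha1 hb1
    · linear_combination e0
    · linear_combination e6
    · linear_combination e7
    · linear_combination e9
  · intro h c _
    have hv := circuit_vec a b l1 l4 l5 l7 ha0 ha1 hb1 h
    exact Matrix.exists_vecMul_eq_zero_iff.1
      ⟨circuitVec a l4, circuitVec_ne a l4, funext fun i => congrFun hv (c i)⟩
  · intro h
    have hv := circuit_vec a b l1 l4 l5 l7 ha0 ha1 hb1 h
    rw [circuit_finrank]
    have : LinearMap.ker (circuitMatrix a b l1 l4 l5 l7).transpose.mulVecLin =
        Submodule.span ℂ {circuitVec a l4} := by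
      ext y
      rw [LinearMap.mem_ker, Matrix.mulVecLin_apply, Matrix.mulVec_transpose,
        Submodule.mem_span_singleton]
      constructor
      · intro hy0
        by_cases hy : y = 0
        · exact ⟨0, by simp [hy]⟩
        obtain ⟨h5, k0, k1, k2, k3, k4, k6⟩ :=
          circuit_core a b l1 l4 l5 l7 y hy (by simp [hy0])
        refine ⟨y 5, ?_⟩
        funext i
        fin_cases i <;> simp [circuitVec, k0, k1, k2, k3, k4, k6, mul_comm]
      · rintro ⟨t, rfl⟩
        rw [Matrix.smul_vecMul, hv, smul_zero]
    rw [this, finrank_span_singleton (circuitVec_ne a l4)]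
  · intro h
    rw [circuit_finrank]
    have : LinearMap.ker (circuitMatrix a b l1 l4 l5 l7).transpose.mulVecLin = ⊥ := by
      rw [LinearMap.ker_eq_bot']
      intro y hy
      rw [Matrix.mulVecLin_apply, Matrix.mulVec_transpose] at hy
      by_contra hne
      exact h (circuit_ker a b l1 l4 l5 l7 ha0 ha1 hb1 y hne hy)
    rw [this, finrank_bot]
end

section
/- Let C be a connected, tree-like nodal curve with rational components and L a line bundle with deg(L) ≥ −1. Then (C, L) is non-special if and only if the restriction of L to every connected subcurve of C has degree ≥ −1. -/
open scoped BigOperators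

noncomputable def glueH {I : Type*} (G : SimpleGraph I) (m : I → ℕ)
    (node : ∀ i j, G.Adj i j → ℂ × ℂ) (i j : I) (h : G.Adj i j) :
    (∀ k, Fin (m k) → ℂ) →ₗ[ℂ] ℂ :=
  glueCond m i j (node i j h) (node j i h.symm)

lemma glueH_apply {I : Type*} (G : SimpleGraph I) (m : I → ℕ)
    (node : ∀ i j, G.Adj i j → ℂ × ℂ) (i j : I) (h : G.Adj i j) (x) :
    glueH G m node i j h x = evalForm (m i) (node i j h).1 (node i j h).2 (x i)
      - evalForm (m j) (node j i h.symm).1 (node j i h.symm).2 (x j) := by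
  simp [glueH, glueCond]

lemma out_adj {I : Type*} (G : SimpleGraph I) (e : G.edgeSet) :
    G.Adj (Quot.out e.1).1 (Quot.out e.1).2 := by
  have h : s((Quot.out e.1).1, (Quot.out e.1).2) = e.1 := Quot.out_eq e.1
  have := e.2
  rw [← h] at this
  exact this

noncomputable def edgeMap {I : Type*} (G : SimpleGraph I) (m : I → ℕ)
    (node : ∀ i j, G.Adj i j → ℂ × ℂ) :
    (∀ k, Fin (m k) → ℂ) →ₗ[ℂ] (G.edgeSet → ℂ) :=
  LinearMap.pi fun e => glueH G m node (Quot.out e.1).1 (Quot.out e.1).2 (out_adj G e)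

lemma glueH_cases {I : Type*} (G : SimpleGraph I) (m : I → ℕ)
    (node : ∀ i j, G.Adj i j → ℂ × ℂ) (a b i j : I) (h : G.Adj a b) (h' : G.Adj i j)
    (he : s(a, b) = s(i, j)) (x) :
    glueH G m node a b h x = glueH G m node i j h' x ∨
    glueH G m node a b h x = - glueH G m node i j h' x := by
  rcases Sym2.eq_iff.1 he with ⟨rfl, rfl⟩ | ⟨rfl, rfl⟩
  · left; rfl
  · right; simp [glueH_apply]

lemma edgeMap_cases {I : Type*} (G : SimpleGraph I) (m : I → ℕ)
    (node : ∀ i j, G.Adj i j → ℂ × ℂ) (e : G.edgeSet) (i j : I) (h' : G.Adj i j)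
    (he : e.1 = s(i, j)) (x) :
    edgeMap G m node x e = glueH G m node i j h' x ∨
    edgeMap G m node x e = - glueH G m node i j h' x := by
  have h : s((Quot.out e.1).1, (Quot.out e.1).2) = e.1 := Quot.out_eq e.1
  exact glueH_cases G m node _ _ i j (out_adj G e) h' (h.trans he) x

lemma ker_edgeMap {I : Type*} (G : SimpleGraph I) (m : I → ℕ)
    (node : ∀ i j, G.Adj i j → ℂ × ℂ) :
    LinearMap.ker (edgeMap G m node) = nodalSections G m node := by
  ext x
  simp only [nodalSections, Submodule.mem_iInf, LinearMap.mem_ker]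
  constructor
  · intro hx i j h
    change glueH G m node i j h x = 0
    rcases edgeMap_cases G m node ⟨s(i, j), h⟩ i j h rfl x with h1 | h1 <;>
      rw [hx] at h1 <;> simpa using h1.symm
  · intro hx
    ext e
    exact hx _ _ _

lemma mulForm (n : ℕ) (α β : ℂ) (v : Fin n → ℂ) : ∃ w : Fin (n + 1) → ℂ, ∀ a b : ℂ,
    evalForm (n + 1) a b w = (α * a + β * b) * evalForm n a b v := by
  refine ⟨fun i => α * (Fin.cons 0 v : Fin (n + 1) → ℂ) i
    + β * (Fin.snoc v 0 : Fin (n + 1) → ℂ) i, fun a b => ?_⟩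
  simp only [evalForm, LinearMap.sum_apply, LinearMap.smul_apply, LinearMap.proj_apply,
    smul_eq_mul, mul_add, Finset.sum_add_distrib, add_mul]
  congr 1
  · rw [Fin.sum_univ_succ]
    simp only [Fin.cons_zero, Fin.cons_succ, mul_zero, zero_add, Finset.mul_sum, Fin.val_succ]
    refine Finset.sum_congr rfl fun i _ => ?_
    rw [show n + 1 - 1 - (i.val + 1) = n - 1 - i.val by omega]
    ring
  · rw [Fin.sum_univ_castSucc]
    simp only [Fin.snoc_castSucc, Fin.snoc_last, mul_zero, add_zero, Finset.mul_sum,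
      Fin.val_castSucc]
    refine Finset.sum_congr rfl fun i _ => ?_
    rw [show n + 1 - 1 - i.val = (n - 1 - i.val) + 1 by omega]
    ring

lemma exists_form_base (n : ℕ) (p : ℂ × ℂ) (hp : p ≠ 0) :
    ∃ v : Fin (n + 1) → ℂ, evalForm (n + 1) p.1 p.2 v ≠ 0 := by
  by_cases h : p.1 = 0
  · have h2 : p.2 ≠ 0 := fun h2 => hp (Prod.ext h h2)
    refine ⟨Pi.single 0 1, ?_⟩
    simp [evalForm, Pi.single_apply, h2]
  · refine ⟨Pi.single (Fin.last n) 1, ?_⟩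
    simp [evalForm, Pi.single_apply, h]

lemma exists_form {ι : Type*} [DecidableEq ι] (pt : ι → ℂ × ℂ) (p : ℂ × ℂ) (hp : p ≠ 0)
    (T : Finset ι) :
    ∀ n : ℕ, T.card < n → (∀ j ∈ T, p.1 * (pt j).2 ≠ (pt j).1 * p.2) →
    ∃ v : Fin n → ℂ, evalForm n p.1 p.2 v ≠ 0 ∧
      ∀ j ∈ T, evalForm n (pt j).1 (pt j).2 v = 0 := by
  induction T using Finset.induction_on with
  | empty =>
    intro n hn _
    obtain ⟨k, rfl⟩ : ∃ k, n = k + 1 := ⟨n - 1, by simp at hn; omega⟩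
    obtain ⟨v, hv⟩ := exists_form_base k p hp
    exact ⟨v, hv, by simp⟩
  | insert j T hj ih =>
    intro n hn hT
    rw [Finset.card_insert_of_notMem hj] at hn
    obtain ⟨k, rfl⟩ : ∃ k, n = k + 1 := ⟨n - 1, by omega⟩
    obtain ⟨v, hv, hv'⟩ := ih k (by omega) (fun i hi => hT i (Finset.mem_insert_of_mem hi))
    obtain ⟨w, hw⟩ := mulForm k ((pt j).2) (-(pt j).1) v
    refine ⟨w, ?_, ?_⟩
    · rw [hw]
      refine mul_ne_zero ?_ hv
      have := hT j (Finset.mem_insert_self _ _)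
      intro h0
      apply this
      linear_combination h0
    · intro i hi
      rw [hw]
      rcases Finset.mem_insert.1 hi with rfl | hi
      · ring
      · rw [hv' i hi, mul_zero]

/-- The graph supporting a relation. -/
def suppGraph {I : Type*} (G : SimpleGraph I) (c : G.edgeSet → ℂ) : SimpleGraph I where
  Adj i j := ∃ h : G.Adj i j, c ⟨s(i, j), h⟩ ≠ 0
  symm := ⟨by
    rintro i j ⟨h, hc⟩
    refine ⟨h.symm, ?_⟩
    have : (⟨s(j, i), h.symm⟩ : G.edgeSet) = ⟨s(i, j), h⟩ := Subtype.ext Sym2.eq_swap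
    rwa [this]⟩
  loopless := ⟨by
    rintro i ⟨h, _⟩
    exact G.loopless.irrefl i h⟩

lemma degree_bound {I : Type*} [Fintype I] [DecidableEq I] (G : SimpleGraph I) (m : I → ℕ)
    (node : ∀ i j, G.Adj i j → ℂ × ℂ) (hnode : NodesOk G node) [Fintype G.edgeSet]
    (c : G.edgeSet → ℂ) (hc : ∀ x, ∑ e, c e * edgeMap G m node x e = 0)
    (i j : I) (hij : (suppGraph G c).Adj i j) (N : Finset I)
    (hN : ∀ k, k ∈ N ↔ (suppGraph G c).Adj i k) : m i + 1 ≤ N.card := by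
  classical
  by_contra hlt
  obtain ⟨hG, hcij⟩ := hij
  have hjN : j ∈ N := (hN j).2 ⟨hG, hcij⟩
  obtain ⟨v, hv, hv'⟩ := exists_form (fun k => if h : G.Adj i k then node i k h else 0)
    (node i j hG) (hnode.1 i j hG) (N.erase j) (m i)
    (by have := Finset.card_erase_add_one hjN; omega) (by
      intro k hk
      obtain ⟨hkj, hk⟩ := Finset.mem_erase.1 hk
      obtain ⟨hk, _⟩ := (hN k).1 hk
      simp only [hk, dif_pos]
      exact hnode.2 i j k hG hk (Ne.symm hkj))
  have key : ∀ k (h : G.Adj i k), glueH G m node i k h (Pi.single i v)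
      = evalForm (m i) (node i k h).1 (node i k h).2 v := by
    intro k h
    rw [glueH_apply, Pi.single_eq_same, Pi.single_eq_of_ne h.ne', map_zero, sub_zero]
  have h0 := hc (Pi.single i v)
  rw [Finset.sum_eq_single (⟨s(i, j), hG⟩ : G.edgeSet)] at h0
  · rcases edgeMap_cases G m node ⟨s(i, j), hG⟩ i j hG rfl (Pi.single i v) with h1 | h1 <;>
      rw [h1, key] at h0 <;> simp_all
  · rintro ⟨e, he⟩ _ hne
    by_cases hi : i ∈ e
    · obtain ⟨k, rfl⟩ := Sym2.mem_iff_exists.1 hi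
      have hik : G.Adj i k := he
      by_cases hck : c ⟨s(i, k), he⟩ = 0
      · rw [hck, zero_mul]
      · have hkj : k ≠ j := by rintro rfl; exact hne rfl
        have hz := hv' k (Finset.mem_erase.2 ⟨hkj, (hN k).2 ⟨hik, hck⟩⟩)
        simp only [hik, dif_pos] at hz
        rcases edgeMap_cases G m node ⟨s(i, k), he⟩ i k hik rfl (Pi.single i v) with h1 | h1 <;>
          rw [h1, key, hz] <;> simp
    · induction e using Sym2.ind with
      | _ a b =>
        have hab : G.Adj a b := he
        have ha : a ≠ i := by rintro rfl; simp at hi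
        have hb : b ≠ i := by rintro rfl; simp at hi
        rcases edgeMap_cases G m node ⟨s(a, b), he⟩ a b hab rfl (Pi.single i v) with h1 | h1 <;>
          rw [h1, glueH_apply, Pi.single_eq_of_ne ha, Pi.single_eq_of_ne hb] <;> simp
  · intro h; exact absurd (Finset.mem_univ _) h

lemma edgeMap_surj {I : Type*} [Fintype I] [DecidableEq I] (G : SimpleGraph I) (hG : G.IsTree)
    (m : I → ℕ) (node : ∀ i j, G.Adj i j → ℂ × ℂ) (hnode : NodesOk G node)
    (hS : ∀ S : Finset I, (G.induce (S : Set I)).Connected → S.card ≤ ∑ i ∈ S, m i + 1) :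
    Function.Surjective (edgeMap G m node) := by
  classical
  rw [← LinearMap.range_eq_top]
  by_contra hne
  obtain ⟨f, hf, hle⟩ := Submodule.exists_le_ker_of_lt_top _ (lt_top_iff_ne_top.2 hne)
  let c : G.edgeSet → ℂ := fun e => f (Pi.single e 1)
  have hfc : ∀ y, f y = ∑ e, c e * y e := by
    intro y
    rw [LinearMap.pi_apply_eq_sum_univ f y]
    refine Finset.sum_congr rfl fun e _ => ?_
    rw [smul_eq_mul, mul_comm]
    congr 2
    ext k
    simp [Pi.single_apply, eq_comm]
  have hc : ∀ x, ∑ e, c e * edgeMap G m node x e = 0 := by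
    intro x
    rw [← hfc]
    exact hle (LinearMap.mem_range_self _ x)
  obtain ⟨e, he⟩ : ∃ e, c e ≠ 0 := by
    by_contra hcon
    push Not at hcon
    apply hf
    refine LinearMap.ext fun y => ?_
    simp [hfc, hcon]
  obtain ⟨⟨a, b⟩, hab⟩ := e
  have hab' : G.Adj a b := hab
  set H := suppGraph G c with hH
  have hHab : H.Adj a b := ⟨hab', he⟩
  have hHG : H ≤ G := fun i j h => h.1
  let K := H.connectedComponentMk a
  let S : Finset I := K.supp.toFinset
  have hSmem : ∀ i, i ∈ S ↔ i ∈ K.supp := fun i => Set.mem_toFinset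
  have hSK : (S : Set I) = K.supp := Set.coe_toFinset _
  have hconn : (H.induce (S : Set I)).Connected := by
    rw [hSK]; exact K.connected_toSimpleGraph
  have hacyc : (H.induce (S : Set I)).IsAcyclic :=
    (hG.2.anti hHG).induce _
  have htree : (H.induce (S : Set I)).IsTree := ⟨hconn, hacyc⟩
  have hGc : (G.induce (S : Set I)).Connected :=
    hconn.mono (fun i j h => hHG h)
  have h1 := hS S hGc
  have h2 := htree.card_edgeFinset
  have h3 := (H.induce (S : Set I)).sum_degrees_eq_twice_card_edges
  have hdeg : ∀ i : (S : Set I), m i.1 + 1 ≤ (H.induce (S : Set I)).degree i := by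
    intro i
    have hiK : H.connectedComponentMk i.1 = K := by
      have := (hSmem i.1).1 i.2
      simpa using this
    obtain ⟨k, hk⟩ : ∃ k, H.Adj i.1 k := by
      by_cases hia : i.1 = a
      · exact ⟨b, hia ▸ hHab⟩
      · obtain ⟨w⟩ := SimpleGraph.ConnectedComponent.exact hiK
        exact ⟨_, w.adj_snd (SimpleGraph.Walk.not_nil_of_ne hia)⟩
    have hd := degree_bound G m node hnode c hc i.1 k hk
      (((H.induce (S : Set I)).neighborFinset i).map (Function.Embedding.subtype _)) (by
        intro l
        simp only [Finset.mem_map, SimpleGraph.mem_neighborFinset, SimpleGraph.comap_adj,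
          Function.Embedding.subtype_apply]
        constructor
        · rintro ⟨l', hl, rfl⟩; exact hl
        · intro hl
          refine ⟨⟨l, ?_⟩, hl, rfl⟩
          have : l ∈ S := by
            rw [hSmem, SimpleGraph.ConnectedComponent.mem_supp_iff, ← hiK]
            exact SimpleGraph.ConnectedComponent.sound (SimpleGraph.Adj.reachable hl.symm)
          exact this)
    rwa [Finset.card_map, SimpleGraph.card_neighborFinset_eq_degree] at hd
  have h4 : ∑ i : (S : Set I), (m i.1 + 1) ≤ _ := Finset.sum_le_sum fun i _ => hdeg i
  rw [h3] at h4
  have h5 : ∑ i : (S : Set I), (m i.1 + 1) = ∑ i ∈ S, (m i + 1) :=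
    Finset.sum_coe_sort S (fun i => m i + 1)
  rw [h5, Finset.sum_add_distrib] at h4
  have h6 : Fintype.card (S : Set I) = S.card := by simp
  rw [h6] at h2
  simp only [Finset.sum_const, smul_eq_mul, mul_one] at h4
  omega

lemma surj_bound {I : Type*} [Fintype I] [DecidableEq I] (G : SimpleGraph I) (hG : G.IsTree)
    (m : I → ℕ) (node : ∀ i j, G.Adj i j → ℂ × ℂ)
    (hsurj : Function.Surjective (edgeMap G m node))
    (S : Finset I) (hS : (G.induce (S : Set I)).Connected) : S.card ≤ ∑ i ∈ S, m i + 1 := by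
  classical
  let ι : (G.induce (S : Set I)).edgeSet ↪ G.edgeSet :=
    (SimpleGraph.Embedding.induce (G := G) (S : Set I)).mapEdgeSet
  let J : (∀ k : (S : Set I), Fin (m k.1) → ℂ) →ₗ[ℂ] (∀ k, Fin (m k) → ℂ) :=
    LinearMap.pi fun k => if h : k ∈ (S : Set I) then
      (LinearMap.proj (⟨k, h⟩ : (S : Set I)) :
        (∀ k : (S : Set I), Fin (m k.1) → ℂ) →ₗ[ℂ] (Fin (m k) → ℂ)) else 0
  have hJ : ∀ y k (h : k ∈ (S : Set I)), J y k = y ⟨k, h⟩ := by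
    intro y k h
    have h' : k ∈ S := h
    simp [J, h']
  let Ψ := (LinearMap.funLeft ℂ ℂ ι).comp ((edgeMap G m node).comp J)
  have hΨ : Function.Surjective Ψ := by
    intro y
    obtain ⟨z, hz⟩ := LinearMap.funLeft_surjective_of_injective ℂ ℂ ι ι.injective y
    obtain ⟨x, hx⟩ := hsurj z
    refine ⟨fun k => x k.1, ?_⟩
    rw [← hz, ← hx]
    ext e
    obtain ⟨e, he⟩ := e
    induction e using Sym2.ind with
    | _ a b =>
      change edgeMap G m node (J fun k => x k.1) (ι ⟨s(a, b), he⟩)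
        = edgeMap G m node x (ι ⟨s(a, b), he⟩)
      have hmem : ∀ k, k ∈ (ι ⟨s(a, b), he⟩).1 → k ∈ (S : Set I) := by
        intro k hk
        have hk' : k ∈ s(a.1, b.1) := hk
        rcases Sym2.mem_iff.1 hk' with rfl | rfl
        · exact a.2
        · exact b.2
      generalize ι ⟨s(a, b), he⟩ = e at hmem
      change glueH G m node _ _ (out_adj G e) _ = glueH G m node _ _ (out_adj G e) _
      have hout : s((Quot.out e.1).1, (Quot.out e.1).2) = e.1 := Quot.out_eq e.1
      have ha : (Quot.out e.1).1 ∈ e.1 := Sym2.mem_iff_exists.2 ⟨_, hout.symm⟩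
      have hb : (Quot.out e.1).2 ∈ e.1 := Sym2.mem_iff_exists.2 ⟨_, hout.symm.trans Sym2.eq_swap⟩
      rw [glueH_apply, glueH_apply, hJ _ _ (hmem _ ha), hJ _ _ (hmem _ hb)]
  have h1 := LinearMap.finrank_le_finrank_of_surjective hΨ
  have htree : (G.induce (S : Set I)).IsTree := ⟨hS, hG.2.induce _⟩
  have h2 := htree.card_edgeFinset
  have h6 : Fintype.card (S : Set I) = S.card := by simp
  have h5 : ∑ i : (S : Set I), m i.1 = ∑ i ∈ S, m i := Finset.sum_coe_sort S m
  rw [Module.finrank_fintype_fun_eq_card, Module.finrank_pi_fintype] at h1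
  simp only [Module.finrank_fintype_fun_eq_card, Fintype.card_fin] at h1
  rw [SimpleGraph.edgeFinset_card] at h2
  rw [h5] at h1
  rw [h6] at h2
  omega

/-- For a connected tree-like rational nodal curve `C` with `deg L = ∑ d i ≥ -1`,
`(C, L)` is non-special (`h⁰(C, L) = deg L + 1`) iff the restriction of `L` to every
connected subcurve of `C` has degree `≥ -1`. -/
theorem statement16 {I : Type} [Fintype I] [DecidableEq I]
    (G : SimpleGraph I) (hG : G.IsTree) (d : I → ℤ)
    (node : ∀ i j, G.Adj i j → ℂ × ℂ) (hnode : NodesOk G node)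
    (hdeg : -1 ≤ ∑ i, d i) :
    (Module.finrank ℂ ↥(nodalSections G (fun i => (d i + 1).toNat) node) : ℤ)
        = (∑ i, d i) + 1
      ↔ ∀ S : Finset I, (G.induce (S : Set I)).Connected → -1 ≤ ∑ i ∈ S, d i := by
  classical
  set m : I → ℕ := fun i => (d i + 1).toNat with hm
  change (Module.finrank ℂ ↥(nodalSections G m node) : ℤ) = (∑ i, d i) + 1 ↔ _
  have hrank := LinearMap.finrank_range_add_finrank_ker (edgeMap G m node)
  rw [ker_edgeMap, Module.finrank_pi_fintype] at hrank
  simp only [Module.finrank_fintype_fun_eq_card, Fintype.card_fin] at hrank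
  have hcard := hG.card_edgeFinset
  rw [SimpleGraph.edgeFinset_card] at hcard
  have hle := Submodule.finrank_le (LinearMap.range (edgeMap G m node))
  rw [Module.finrank_fintype_fun_eq_card] at hle
  have hmd : ∀ i, 0 ≤ (m i : ℤ) - (d i + 1) := fun i => by simp only [hm]; omega
  have hsum : ∀ S : Finset I, ∑ i ∈ S, ((m i : ℤ) - (d i + 1))
      = ((∑ i ∈ S, m i : ℕ) : ℤ) - (∑ i ∈ S, d i) - S.card := by
    intro S
    rw [Finset.sum_sub_distrib, Finset.sum_add_distrib]
    push_cast
    simp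
    ring
  have hall := hsum Finset.univ
  have hall0 : 0 ≤ ∑ i, ((m i : ℤ) - (d i + 1)) := Finset.sum_nonneg fun i _ => hmd i
  rw [Finset.card_univ] at hall
  constructor
  · intro hfin S hS
    have hsurj : Function.Surjective (edgeMap G m node) := by
      rw [← LinearMap.range_eq_top]
      apply Submodule.eq_top_of_finrank_eq
      rw [Module.finrank_fintype_fun_eq_card]
      omega
    have hb := surj_bound G hG m node hsurj S hS
    have h1 : ∑ i ∈ S, ((m i : ℤ) - (d i + 1)) ≤ ∑ i, ((m i : ℤ) - (d i + 1)) :=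
      Finset.sum_le_sum_of_subset_of_nonneg (Finset.subset_univ _) fun i _ _ => hmd i
    have h2 := hsum S
    omega
  · intro hS
    have hsurj := edgeMap_surj G hG m node hnode (by
      intro S hc
      have h1 := hS S hc
      have h2 := hsum S
      have h3 : 0 ≤ ∑ i ∈ S, ((m i : ℤ) - (d i + 1)) := Finset.sum_nonneg fun i _ => hmd i
      omega)
    rw [LinearMap.range_eq_top.2 hsurj, finrank_top, Module.finrank_fintype_fun_eq_card] at hrank
    have hd : ∀ i, -1 ≤ d i := by
      intro i
      have := hS {i} (by
        rw [Finset.coe_singleton]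
        exact (SimpleGraph.IsTree.of_subsingleton).1)
      simpa using this
    have hz : ∑ i, ((m i : ℤ) - (d i + 1)) = 0 := Finset.sum_eq_zero fun i _ => by
      have := hd i
      simp only [hm]; omega
    omega
end
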